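/- Let R be a commutative ring with identity. Every comorphic R-module M is Hopfian, i.e., every surjective R-endomorphism of M is an isomorphism. -/

import Mathlib

open Pointwise

/-- A proper submodule `L` of a module is completely irreducible if whenever `L` is the
intersection of a family of submodules, it equals one of them. -/
def CompletelyIrreducible {R M : Type*} [CommRing R] [AddCommGroup M] [Module R M]
    (L : Submodule R M) : Prop :=
  L ≠ ⊤ ∧ ∀ S : Set (Submodule R M), L = sInf S → L ∈ S

/-- `M` is a comorphic `R`-module if every completely irreducible submodule `L`
satisfies `L = aM` and `(L :_R M) = Ra + Ann_R(M)` for some `a ∈ R`. -/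
def Comorphic (R M : Type*) [CommRing R] [AddCommGroup M] [Module R M] : Prop :=
  ∀ L : Submodule R M, CompletelyIrreducible L →
    ∃ a : R, L = a • (⊤ : Submodule R M) ∧
      L.colon ⊤ = Ideal.span {a} + (⊤ : Submodule R M).annihilator

theorem CompletelyIrreducible.comap {R M N : Type*} [CommRing R] [AddCommGroup M] [Module R M]
    [AddCommGroup N] [Module R N] {L : Submodule R N} (hL : CompletelyIrreducible L)
    {f : M →ₗ[R] N} (hf : Function.Surjective f) : CompletelyIrreducible (L.comap f) := by
  refine ⟨fun h => hL.1 ?_, fun S hS => ?_⟩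
  · rw [← Submodule.map_comap_eq_of_surjective hf L, h, Submodule.map_top,
      LinearMap.range_eq_top.2 hf]
  · refine hL.2 {P | P.comap f ∈ S} (le_antisymm (le_sInf fun P hP => ?_) fun y hy => ?_)
    · rw [← Submodule.comap_le_comap_iff_of_surjective hf, hS]
      exact sInf_le hP
    · obtain ⟨z, rfl⟩ := hf y
      rw [← Submodule.mem_comap, hS, Submodule.mem_sInf]
      intro P hP
      have hker : LinearMap.ker f ≤ P :=
        (Submodule.comap_mono bot_le).trans (hS.trans_le (sInf_le hP))
      have hcomap : (P.map f).comap f = P := by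
        rw [Submodule.comap_map_eq, sup_eq_left.2 hker]
      rw [← hcomap]
      exact Submodule.mem_sInf.1 hy (P.map f) (by simpa [hcomap] using hP)

theorem exists_completelyIrreducible_notMem {R M : Type*} [CommRing R] [AddCommGroup M]
    [Module R M] {x : M} (hx : x ≠ 0) : ∃ L : Submodule R M, CompletelyIrreducible L ∧ x ∉ L := by
  obtain ⟨L, -, hL⟩ := zorn_le_nonempty₀ {L : Submodule R M | x ∉ L}
    (fun c hc hchain P hP => ⟨sSup c, fun hmem => by
      obtain ⟨Q, hQ, hxQ⟩ := (Submodule.mem_sSup_of_directed ⟨P, hP⟩ hchain.directedOn).1 hmem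
      exact hc hQ hxQ, fun _ => le_sSup⟩) ⊥ (by simpa using hx)
  refine ⟨L, ⟨fun h => hL.prop (h ▸ Submodule.mem_top), fun S hS => ?_⟩, hL.prop⟩
  by_contra hLS
  refine hL.prop (hS ▸ Submodule.mem_sInf.2 fun P hP => ?_)
  by_contra hxP
  exact hLS (hL.eq_of_le hxP (hS.trans_le (sInf_le hP)) ▸ hP)

theorem comorphic_hopfian {R M : Type*} [CommRing R] [AddCommGroup M] [Module R M]
    (hM : Comorphic R M) :
    ∀ f : M →ₗ[R] M, Function.Surjective f → Function.Bijective f := by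
  refine fun f hf => ⟨(injective_iff_map_eq_zero f).2 fun x hx => ?_, hf⟩
  by_contra hx0
  obtain ⟨L, hL, hxL⟩ := exists_completelyIrreducible_notMem (R := R) hx0
  obtain ⟨a, ha, -⟩ := hM _ (hL.comap hf)
  have hxa : x ∈ a • (⊤ : Submodule R M) := by
    rw [← ha, Submodule.mem_comap, hx]
    exact L.zero_mem
  obtain ⟨m, -, rfl⟩ := (Submodule.mem_smul_pointwise_iff_exists _ _ _).1 hxa
  obtain ⟨n, rfl⟩ := hf m
  have han : a • n ∈ L.comap f := ha ▸ Submodule.smul_mem_pointwise_smul n a ⊤ Submodule.mem_top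
  exact hxL (by simpa using han)
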